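/- Let α, β, γ > −1. For integers 0 ≤ k ≤ n define P_{n,k}^{(α,β,γ)}(x,y) := (1−x)^k · P_{n−k}^{(α, β+γ+2k+1)}(1−2x) · P_k^{(β,γ)}(1 − 2y/(1−x)); this is a bivariate polynomial of total degree n. Then for (n,k) ≠ (m,j) one has ∫∫_{T_1} P_{n,k}^{(α,β,γ)}(x,y) P_{m,j}^{(α,β,γ)}(x,y) x^α y^β (1−x−y)^γ dx dy = 0, and the system {P_{m,j}^{(α,β,γ)}}_{0 ≤ j ≤ m ≤ n} is an orthogonal basis of the space of bivariate polynomials of total degree ≤ n with respect to the inner product of L²(T_1, x^α y^β (1−x−y)^γ dx dy). -/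

import Mathlib

open MeasureTheory Finset

noncomputable section

/-- Shifted factorial (Pochhammer symbol) `(a)_k = a (a+1) ⋯ (a+k-1)`. -/
def poch (a : ℝ) (k : ℕ) : ℝ := ∏ j ∈ Finset.range k, (a + j)

/-- The Jacobi polynomial `P_n^{(a,b)}` as a univariate real polynomial,
`P_n^{(a,b)}(x) = ((a+1)_n/n!) Σ_{k=0}^n ((-n)_k (n+a+b+1)_k)/((a+1)_k k!) ((1-x)/2)^k`. -/
def jacobiPoly (n : ℕ) (a b : ℝ) : Polynomial ℝ :=
  Polynomial.C (poch (a + 1) n / (n.factorial : ℝ)) *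
    ∑ k ∈ Finset.range (n + 1),
      Polynomial.C (poch (-(n : ℝ)) k * poch ((n : ℝ) + a + b + 1) k /
          (poch (a + 1) k * (k.factorial : ℝ))) *
        (Polynomial.C (2⁻¹ : ℝ) * (1 - Polynomial.X)) ^ k

/-- The value `P_n^{(a,b)}(x)` of the Jacobi polynomial. -/
def jacobiR (n : ℕ) (a b x : ℝ) : ℝ := (jacobiPoly n a b).eval x

/-- Substitute a bivariate polynomial into a univariate polynomial. -/
def substX (f : Polynomial ℝ) (g : MvPolynomial (Fin 2) ℝ) : MvPolynomial (Fin 2) ℝ :=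
  Polynomial.aeval g f

/-- The open unit triangle `T₁ = {(x,y) : x > 0, y > 0, 1 - x - y > 0}`. -/
def T1 : Set (ℝ × ℝ) := {p : ℝ × ℝ | 0 < p.1 ∧ 0 < p.2 ∧ 0 < 1 - p.1 - p.2}

/-- Evaluation of a bivariate polynomial at a point of `ℝ²`. -/
def evalP (u : MvPolynomial (Fin 2) ℝ) (p : ℝ × ℝ) : ℝ :=
  MvPolynomial.eval ![p.1, p.2] u

theorem poch_succ (a : ℝ) (k : ℕ) : poch a (k + 1) = poch a k * (a + k) :=
  Finset.prod_range_succ _ _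

theorem poch_pos {a : ℝ} (ha : 0 < a) (k : ℕ) : 0 < poch a k :=
  Finset.prod_pos fun _ _ => by positivity

theorem poch_neg_natCast_eq_zero {n i : ℕ} (h : n < i) : poch (-(n : ℝ)) i = 0 :=
  Finset.prod_eq_zero (Finset.mem_range.2 h) (by simp)

theorem poch_neg_natCast_ne_zero {n i : ℕ} (h : i ≤ n) : poch (-(n : ℝ)) i ≠ 0 := by
  refine Finset.prod_ne_zero_iff.2 fun j hj => ?_
  have : (j : ℝ) < n := by exact_mod_cast (Finset.mem_range.1 hj).trans_le h
  linarith

/-- The Jacobi polynomial transplanted to `[0, 1]`, that is `t ↦ P_n^{(a,b)}(1 - 2t)`. -/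
def shiftedJacobi (n : ℕ) (a b : ℝ) : Polynomial ℝ :=
  (jacobiPoly n a b).comp (1 - Polynomial.C 2 * Polynomial.X)

theorem eval_shiftedJacobi (n : ℕ) (a b t : ℝ) :
    (shiftedJacobi n a b).eval t = jacobiR n a b (1 - 2 * t) := by
  simp [shiftedJacobi, jacobiR, Polynomial.eval_comp]

theorem coeff_shiftedJacobi (n : ℕ) (a b : ℝ) (i : ℕ) :
    (shiftedJacobi n a b).coeff i = poch (a + 1) n / (n.factorial : ℝ) *
      (poch (-(n : ℝ)) i * poch ((n : ℝ) + a + b + 1) i /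
        (poch (a + 1) i * (i.factorial : ℝ))) := by
  have hX : (Polynomial.C (2⁻¹ : ℝ) * (1 - Polynomial.X)).comp
      (1 - Polynomial.C 2 * Polynomial.X) = Polynomial.X := by
    have h2 : (Polynomial.C (2⁻¹ : ℝ)) * Polynomial.C 2 = 1 := by
      rw [← Polynomial.C_mul]; norm_num
    simp only [Polynomial.mul_comp, Polynomial.C_comp, Polynomial.sub_comp, Polynomial.one_comp,
      Polynomial.X_comp]
    linear_combination (Polynomial.X : Polynomial ℝ) * h2
  rw [shiftedJacobi, jacobiPoly, Polynomial.mul_comp, Polynomial.C_comp, Polynomial.coeff_C_mul,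
    Polynomial.sum_comp, Polynomial.finsetSum_coeff]
  congr 1
  have hterm (c : ℝ) (k : ℕ) : ((Polynomial.C c * (Polynomial.C (2⁻¹ : ℝ) *
      (1 - Polynomial.X)) ^ k).comp (1 - Polynomial.C 2 * Polynomial.X)).coeff i =
      if i = k then c else 0 := by
    rw [Polynomial.mul_comp, Polynomial.pow_comp, hX, Polynomial.C_comp,
      Polynomial.coeff_C_mul_X_pow]
  simp only [hterm]
  rw [Finset.sum_ite_eq]
  split_ifs with h
  · rfl
  · rw [poch_neg_natCast_eq_zero (by simpa using h)]
    simp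

theorem natDegree_shiftedJacobi_le (n : ℕ) (a b : ℝ) : (shiftedJacobi n a b).natDegree ≤ n :=
  Polynomial.natDegree_le_iff_coeff_eq_zero.2 fun i hi => by
    simp [coeff_shiftedJacobi, poch_neg_natCast_eq_zero hi]

theorem coeff_shiftedJacobi_self_ne_zero (n : ℕ) {a b : ℝ} (ha : -1 < a) (hb : -1 < b) :
    (shiftedJacobi n a b).coeff n ≠ 0 := by
  have h1 := (poch_pos (by linarith : 0 < a + 1) n).ne'
  have h2 := poch_neg_natCast_ne_zero (le_refl n)
  have h3 : poch ((n : ℝ) + a + b + 1) n ≠ 0 := by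
    rcases n with _ | n
    · simp [poch]
    · refine (poch_pos ?_ _).ne'
      push_cast
      linarith [(n.cast_nonneg : (0 : ℝ) ≤ n)]
  have h4 : (n.factorial : ℝ) ≠ 0 := by positivity
  rw [coeff_shiftedJacobi]
  positivity

theorem natDegree_shiftedJacobi (n : ℕ) {a b : ℝ} (ha : -1 < a) (hb : -1 < b) :
    (shiftedJacobi n a b).natDegree = n :=
  (natDegree_shiftedJacobi_le n a b).antisymm
    (Polynomial.le_natDegree_of_ne_zero (coeff_shiftedJacobi_self_ne_zero n ha hb))

theorem coeff_succ_shiftedJacobi (n : ℕ) {a : ℝ} (ha : -1 < a) (b : ℝ) (i : ℕ) :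
    (shiftedJacobi n a b).coeff (i + 1) * ((i + 1) * (a + 1 + i)) =
      (shiftedJacobi n a b).coeff i * ((i - n) * (i + n + a + b + 1)) := by
  have h1 := (poch_pos (by linarith : 0 < a + 1) i).ne'
  have h2 : a + 1 + i ≠ 0 := by linarith [(i.cast_nonneg : (0 : ℝ) ≤ i)]
  simp only [coeff_shiftedJacobi, poch_succ, Nat.factorial_succ]
  push_cast
  field_simp
  ring

theorem Polynomial.hypergeometric_ode_of_coeff {p : Polynomial ℝ} {A B D : ℝ}
    (h : ∀ i : ℕ, p.coeff (i + 1) * ((i + 1) * (A + i)) =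
      p.coeff i * (i * (i - 1) + B * i - D)) :
    Polynomial.X * (1 - Polynomial.X) * p.derivative.derivative +
      (Polynomial.C A - Polynomial.C B * Polynomial.X) * p.derivative +
      Polynomial.C D * p = 0 := by
  ext i
  have key := h i
  rcases i with _ | _ | i <;>
  · simp [mul_sub, sub_mul, mul_assoc, Polynomial.coeff_derivative, Polynomial.coeff_X_mul,
      Polynomial.mul_coeff_zero] at key ⊢
    linear_combination key

/-- The hypergeometric differential equation of the shifted Jacobi polynomials. -/
theorem shiftedJacobi_ode (n : ℕ) {a : ℝ} (ha : -1 < a) (b : ℝ) :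
    Polynomial.X * (1 - Polynomial.X) * (shiftedJacobi n a b).derivative.derivative +
      (Polynomial.C (a + 1) - Polynomial.C (a + b + 2) * Polynomial.X) *
        (shiftedJacobi n a b).derivative +
      Polynomial.C (n * (n + a + b + 1)) * shiftedJacobi n a b = 0 :=
  Polynomial.hypergeometric_ode_of_coeff fun i => by
    rw [coeff_succ_shiftedJacobi n ha b i]
    ring

theorem integral_shiftedJacobi_mul {a b : ℝ} (ha : -1 < a) (hb : -1 < b) {n m : ℕ}
    (hnm : n ≠ m) :
    ∫ t in (0 : ℝ)..1, (shiftedJacobi n a b).eval t * (shiftedJacobi m a b).eval t *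
      (t ^ a * (1 - t) ^ b) = 0 := by
  set p := shiftedJacobi n a b with hp
  set q := shiftedJacobi m a b with hq
  by_cases hw : IntervalIntegrable
    (fun t : ℝ => p.eval t * q.eval t * (t ^ a * (1 - t) ^ b)) volume 0 1
  swap
  · exact intervalIntegral.integral_undef hw
  set l : ℝ := m * (m + a + b + 1) - n * (n + a + b + 1) with hl
  have hl0 : l ≠ 0 := by
    have h1 : l = ((m : ℝ) - n) * (m + n + a + b + 1) := by rw [hl]; ring
    have h2 : (m : ℝ) - n ≠ 0 := sub_ne_zero.2 (by exact_mod_cast hnm.symm)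
    have h3 : (1 : ℝ) ≤ m + n := by
      have : 1 ≤ m + n := by omega
      exact_mod_cast this
    rw [h1]
    exact mul_ne_zero h2 (by linarith)
  have hftc := intervalIntegral.integral_eq_sub_of_hasDerivAt_of_le (a := 0) (b := 1)
    (f := fun t : ℝ => t ^ (a + 1) * (1 - t) ^ (b + 1) *
      (p.derivative.eval t * q.eval t - p.eval t * q.derivative.eval t))
    (f' := fun t : ℝ => l * (p.eval t * q.eval t * (t ^ a * (1 - t) ^ b)))
    zero_le_one ?_ ?_ (hw.const_mul l)
  · rw [intervalIntegral.integral_const_mul] at hftc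
    have ha' : a + 1 ≠ 0 := by linarith
    have hb' : b + 1 ≠ 0 := by linarith
    simpa [hl0, Real.zero_rpow ha', Real.zero_rpow hb'] using hftc
  · refine ContinuousOn.mul (ContinuousOn.mul ?_ ?_) ?_
    · exact continuousOn_id.rpow_const fun _ _ => Or.inr (by linarith)
    · exact (continuousOn_const.sub continuousOn_id).rpow_const fun _ _ => Or.inr (by linarith)
    · fun_prop
  · rintro t ⟨h0, h1⟩
    have h1' : 0 < 1 - t := by linarith
    have d1 := (hasDerivAt_id t).rpow_const (p := a + 1) (Or.inl h0.ne')
    have d2 := ((hasDerivAt_id t).const_sub 1).rpow_const (p := b + 1) (Or.inl h1'.ne')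
    have d3 := ((p.derivative.hasDerivAt t).mul (q.hasDerivAt t)).sub
      ((p.hasDerivAt t).mul (q.derivative.hasDerivAt t))
    have odep := congrArg (Polynomial.eval t) (shiftedJacobi_ode n ha b)
    have odeq := congrArg (Polynomial.eval t) (shiftedJacobi_ode m ha b)
    rw [← hp] at odep
    rw [← hq] at odeq
    simp only [Polynomial.eval_add, Polynomial.eval_mul, Polynomial.eval_sub, Polynomial.eval_C,
      Polynomial.eval_X, Polynomial.eval_one, Polynomial.eval_zero] at odep odeq
    refine ((d1.mul d2).mul d3).congr_deriv ?_
    simp only [id, add_sub_cancel_right, Real.rpow_add h0, Real.rpow_add h1', Real.rpow_one,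
      Pi.mul_apply, Pi.sub_apply]
    rw [hl]
    linear_combination (t ^ a * (1 - t) ^ b) * (q.eval t * odep - p.eval t * odeq)

theorem measurableSet_T1 : MeasurableSet T1 :=
  (measurableSet_lt measurable_const measurable_fst).inter
    ((measurableSet_lt measurable_const measurable_snd).inter
      (measurableSet_lt measurable_const ((measurable_const.sub measurable_fst).sub measurable_snd)))

/-- The Duffy map `(x, t) ↦ (x, (1 - x) t)` turns integrals over the triangle into integrals over
the unit square, which factor when the transported integrand does. -/
theorem setIntegral_T1_eq_mul {F : ℝ × ℝ → ℝ} {u v : ℝ → ℝ} (hF : IntegrableOn F T1)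
    (h : ∀ x ∈ Set.Ioo (0 : ℝ) 1, ∀ t ∈ Set.Ioo (0 : ℝ) 1,
      (1 - x) * F (x, (1 - x) * t) = u x * v t) :
    ∫ p in T1, F p = (∫ x in (0 : ℝ)..1, u x) * ∫ t in (0 : ℝ)..1, v t := by
  have inner (x : ℝ) : ∫ y, T1.indicator F (x, y) =
      (Set.Ioo (0 : ℝ) 1).indicator (fun x => u x * ∫ t in (0 : ℝ)..1, v t) x := by
    by_cases hx : x ∈ Set.Ioo (0 : ℝ) 1
    · have hx1 : 0 < 1 - x := by linarith [hx.2]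
      have hind (y : ℝ) : T1.indicator F (x, y) =
          (Set.Ioo (0 : ℝ) (1 - x)).indicator (fun y => F (x, y)) y := by
        have : (x, y) ∈ T1 ↔ y ∈ Set.Ioo (0 : ℝ) (1 - x) := by
          simp [T1, hx.1]
        by_cases hy : y ∈ Set.Ioo (0 : ℝ) (1 - x)
        · rw [Set.indicator_of_mem hy, Set.indicator_of_mem (this.2 hy)]
        · rw [Set.indicator_of_notMem hy, Set.indicator_of_notMem (mt this.1 hy)]
      simp_rw [hind]
      rw [integral_indicator measurableSet_Ioo, ← integral_Ioc_eq_integral_Ioo,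
        ← intervalIntegral.integral_of_le hx1.le, Set.indicator_of_mem hx,
        ← intervalIntegral.integral_const_mul]
      have hs := intervalIntegral.smul_integral_comp_mul_left (a := 0) (b := 1)
        (fun y => F (x, y)) (1 - x)
      rw [mul_zero, mul_one, smul_eq_mul, ← intervalIntegral.integral_const_mul] at hs
      rw [← hs]
      simp only [intervalIntegral.integral_of_le zero_le_one, integral_Ioc_eq_integral_Ioo]
      exact setIntegral_congr_fun measurableSet_Ioo fun t ht => h x hx t ht
    · rw [Set.indicator_of_notMem hx]
      refine (integral_congr_ae (Filter.Eventually.of_forall fun y => ?_)).trans (integral_zero _ _)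
      refine Set.indicator_of_notMem (fun hy => hx ⟨hy.1, ?_⟩) _
      have h2 := hy.2.1
      have h3 := hy.2.2
      dsimp only at h2 h3
      linarith
  rw [← integral_indicator measurableSet_T1, Measure.volume_eq_prod, integral_prod _ (by
    rw [← Measure.volume_eq_prod]; exact hF.integrable_indicator measurableSet_T1)]
  simp_rw [inner]
  rw [integral_indicator measurableSet_Ioo, ← integral_Ioc_eq_integral_Ioo,
    ← intervalIntegral.integral_of_le zero_le_one, intervalIntegral.integral_mul_const]

/-- The polynomial `(1 - x) ^ k * p (y / (1 - x))` in the variables `x, y`, for `p` of degree at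
most `k`. -/
def homogenizeAt (k : ℕ) (p : Polynomial ℝ) : MvPolynomial (Fin 2) ℝ :=
  ∑ i ∈ Finset.range (k + 1),
    MvPolynomial.C (p.coeff i) * MvPolynomial.X 1 ^ i * (1 - MvPolynomial.X 0) ^ (k - i)

theorem evalP_homogenizeAt {k : ℕ} {f : Polynomial ℝ} (hf : f.natDegree ≤ k) {p : ℝ × ℝ}
    (hp : p.1 ≠ 1) :
    evalP (homogenizeAt k f) p = (1 - p.1) ^ k * f.eval (p.2 / (1 - p.1)) := by
  have h1 : 1 - p.1 ≠ 0 := sub_ne_zero.2 hp.symm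
  rw [Polynomial.eval_eq_sum_range' (Nat.lt_succ_of_le hf), Finset.mul_sum]
  simp only [evalP, homogenizeAt, map_sum, map_mul, map_pow, map_sub, map_one,
    MvPolynomial.eval_C, MvPolynomial.eval_X, Matrix.cons_val_zero, Matrix.cons_val_one]
  refine Finset.sum_congr rfl fun i hi => ?_
  have hik : i ≤ k := Nat.lt_succ_iff.1 (Finset.mem_range.1 hi)
  rw [← Nat.sub_add_cancel hik, pow_add, Nat.add_sub_cancel, div_pow]
  field_simp

theorem evalP_substX_X_zero (f : Polynomial ℝ) (p : ℝ × ℝ) :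
    evalP (substX f (MvPolynomial.X 0)) p = f.eval p.1 := by
  have h := Polynomial.aeval_algHom_apply
    (MvPolynomial.aeval ![p.1, p.2] : MvPolynomial (Fin 2) ℝ →ₐ[ℝ] ℝ) (MvPolynomial.X 0) f
  simpa [evalP, substX, MvPolynomial.coe_aeval_eq_eval] using h.symm

theorem totalDegree_substX_X_zero (f : Polynomial ℝ) :
    (substX f (MvPolynomial.X 0)).totalDegree = f.natDegree := by
  apply le_antisymm
  · rw [substX, Polynomial.aeval_eq_sum_range]
    refine MvPolynomial.totalDegree_finsetSum_le fun i hi => ?_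
    refine (MvPolynomial.totalDegree_smul_le _ _).trans ?_
    rw [MvPolynomial.totalDegree_X_pow]
    exact Nat.lt_succ_iff.1 (Finset.mem_range.1 hi)
  · have h := MvPolynomial.aeval_natDegree_le (substX f (MvPolynomial.X 0)) le_rfl
      (![Polynomial.X, 0] : Fin 2 → Polynomial ℝ) (n := 1) (by simp [Fin.forall_fin_two])
    simpa [substX, ← Polynomial.aeval_algHom_apply] using h

theorem totalDegree_homogenizeAt {k : ℕ} {f : Polynomial ℝ} (hf : f.natDegree = k) :
    (homogenizeAt k f).totalDegree = k := by
  apply le_antisymm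
  · refine MvPolynomial.totalDegree_finsetSum_le fun i hi => ?_
    have hik : i ≤ k := Nat.lt_succ_iff.1 (Finset.mem_range.1 hi)
    have h1 : (1 - MvPolynomial.X 0 : MvPolynomial (Fin 2) ℝ).totalDegree ≤ 1 :=
      (MvPolynomial.totalDegree_sub _ _).trans (by simp)
    calc _ ≤ (MvPolynomial.C (f.coeff i) * MvPolynomial.X 1 ^ i :
            MvPolynomial (Fin 2) ℝ).totalDegree +
          ((1 - MvPolynomial.X 0 : MvPolynomial (Fin 2) ℝ) ^ (k - i)).totalDegree :=
          MvPolynomial.totalDegree_mul _ _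
      _ ≤ i + (k - i) * 1 := by
          gcongr
          · refine (MvPolynomial.totalDegree_mul _ _).trans ?_
            simp [MvPolynomial.totalDegree_X_pow]
          · exact (MvPolynomial.totalDegree_pow _ _).trans (Nat.mul_le_mul_left _ h1)
      _ = k := by omega
  · have h := MvPolynomial.aeval_natDegree_le (homogenizeAt k f) le_rfl
      (![0, Polynomial.X] : Fin 2 → Polynomial ℝ) (n := 1) (by simp [Fin.forall_fin_two])
    have h2 : MvPolynomial.aeval ![0, Polynomial.X] (homogenizeAt k f) = f := by
      conv_rhs => rw [f.as_sum_range_C_mul_X_pow, hf]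
      simp [homogenizeAt, Polynomial.C_eq_algebraMap]
    rwa [h2, hf, mul_one] at h

/-- The orthogonal polynomial `P_{n,k}^{(a,b,g)}` on the triangle, as a bivariate polynomial. -/
def trianglePoly (a b g : ℝ) (n k : ℕ) : MvPolynomial (Fin 2) ℝ :=
  substX (shiftedJacobi (n - k) a (b + g + 2 * (k : ℝ) + 1)) (MvPolynomial.X 0) *
    homogenizeAt k (shiftedJacobi k b g)

theorem evalP_trianglePoly (a b g : ℝ) (n k : ℕ) {p : ℝ × ℝ} (hp : p.1 ≠ 1) :
    evalP (trianglePoly a b g n k) p =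
      (shiftedJacobi (n - k) a (b + g + 2 * (k : ℝ) + 1)).eval p.1 *
        ((1 - p.1) ^ k * (shiftedJacobi k b g).eval (p.2 / (1 - p.1))) := by
  rw [← evalP_homogenizeAt (natDegree_shiftedJacobi_le k b g) hp, ← evalP_substX_X_zero]
  simp [trianglePoly, evalP]

theorem totalDegree_trianglePoly {a b g : ℝ} (ha : -1 < a) (hb : -1 < b) (hg : -1 < g) {n k : ℕ}
    (hk : k ≤ n) : (trianglePoly a b g n k).totalDegree = n := by
  have hbg : -1 < b + g + 2 * (k : ℝ) + 1 := by linarith [(k.cast_nonneg : (0 : ℝ) ≤ k)]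
  have h1 := totalDegree_substX_X_zero (shiftedJacobi (n - k) a (b + g + 2 * (k : ℝ) + 1))
  have h2 := totalDegree_homogenizeAt (natDegree_shiftedJacobi k hb hg)
  have hne1 : substX (shiftedJacobi (n - k) a (b + g + 2 * (k : ℝ) + 1))
      (MvPolynomial.X 0 : MvPolynomial (Fin 2) ℝ) ≠ 0 := by
    intro h0
    refine coeff_shiftedJacobi_self_ne_zero (n - k) ha hbg ?_
    have : shiftedJacobi (n - k) a (b + g + 2 * (k : ℝ) + 1) = 0 :=
      Polynomial.funext fun t => by
        rw [← evalP_substX_X_zero _ (t, 0), h0]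
        simp [evalP]
    simp [this]
  have hne2 : homogenizeAt k (shiftedJacobi k b g) ≠ 0 := by
    intro h0
    refine coeff_shiftedJacobi_self_ne_zero k hb hg ?_
    have : shiftedJacobi k b g = 0 :=
      Polynomial.funext fun t => by
        have h := evalP_homogenizeAt (natDegree_shiftedJacobi_le k b g)
          (p := ((0 : ℝ), t)) zero_ne_one
        rw [h0] at h
        simpa [evalP] using h.symm
    simp [this]
  rw [trianglePoly, MvPolynomial.totalDegree_mul_of_isDomain hne1 hne2, h1, h2,
    natDegree_shiftedJacobi _ ha hbg, Nat.sub_add_cancel hk]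

theorem setIntegral_trianglePoly_mul {a b g : ℝ} (ha : -1 < a) (hb : -1 < b) (hg : -1 < g)
    {n k m j : ℕ} (hk : k ≤ n) (hj : j ≤ m) (hne : (n, k) ≠ (m, j)) :
    ∫ p in T1, evalP (trianglePoly a b g n k) p * evalP (trianglePoly a b g m j) p *
      (p.1 ^ a * p.2 ^ b * (1 - p.1 - p.2) ^ g) = 0 := by
  by_cases hF : IntegrableOn (fun p : ℝ × ℝ => evalP (trianglePoly a b g n k) p *
      evalP (trianglePoly a b g m j) p * (p.1 ^ a * p.2 ^ b * (1 - p.1 - p.2) ^ g)) T1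
  swap
  · exact integral_undef hF
  rw [setIntegral_T1_eq_mul hF
    (u := fun x => (shiftedJacobi (n - k) a (b + g + 2 * (k : ℝ) + 1)).eval x *
      (shiftedJacobi (m - j) a (b + g + 2 * (j : ℝ) + 1)).eval x *
        (x ^ a * (1 - x) ^ (b + g + (k + j : ℝ) + 1)))
    (v := fun t => (shiftedJacobi k b g).eval t * (shiftedJacobi j b g).eval t *
      (t ^ b * (1 - t) ^ g))]
  · by_cases hkj : k = j
    · subst hkj
      have hnm : n - k ≠ m - k := fun h => hne (by rw [show n = m by omega])
      have h := integral_shiftedJacobi_mul ha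
        (show -1 < b + g + 2 * (k : ℝ) + 1 by linarith [(k.cast_nonneg : (0 : ℝ) ≤ k)]) hnm
      rw [← two_mul, h, zero_mul]
    · rw [integral_shiftedJacobi_mul hb hg hkj, mul_zero]
  · rintro x ⟨hx0, hx1⟩ t ⟨ht0, ht1⟩
    have hx : 0 < 1 - x := by linarith
    have ht : 0 < 1 - t := by linarith
    have hs : 1 - x - (1 - x) * t = (1 - x) * (1 - t) := by ring
    simp only [evalP_trianglePoly (p := (x, (1 - x) * t)) _ _ _ _ _ hx1.ne,
      mul_div_cancel_left₀ t hx.ne', hs, Real.mul_rpow hx.le ht.le, Real.mul_rpow hx.le ht0.le,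
      Real.rpow_add hx, Real.rpow_natCast, Real.rpow_one]
    ring

theorem Polynomial.mem_span_image_Iic_of_natDegree_le {S : ℕ → Polynomial ℝ}
    (hdeg : ∀ i, (S i).natDegree = i) (hS : ∀ i, S i ≠ 0) {f : Polynomial ℝ} {d : ℕ}
    (hf : f.natDegree ≤ d) : f ∈ Submodule.span ℝ (S '' Set.Iic d) := by
  let s : Polynomial.Sequence ℝ :=
    ⟨S, fun i => by rw [Polynomial.degree_eq_natDegree (hS i), hdeg i]⟩
  have h := s.span_degreeLE (m := d) fun i _ => (Polynomial.leadingCoeff_ne_zero.2 (hS i)).isUnit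
  change f ∈ Submodule.span ℝ (s '' Set.Iic d)
  rw [h, Polynomial.mem_degreeLE]
  exact Polynomial.natDegree_le_iff_degree_le.1 hf

/-- The span of the triangle polynomials `P_{m,j}^{(a,b,g)}` with `j ≤ m ≤ N`. -/
def triangleSpan (a b g : ℝ) (N : ℕ) : Submodule ℝ (MvPolynomial (Fin 2) ℝ) :=
  Submodule.span ℝ {q | ∃ m j, j ≤ m ∧ m ≤ N ∧ trianglePoly a b g m j = q}

theorem substX_mul_homogenizeAt_mem_triangleSpan {a b g : ℝ} (ha : -1 < a) (hb : -1 < b)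
    (hg : -1 < g) (N : ℕ) {k : ℕ} {f : Polynomial ℝ}
    (hf : f.natDegree + k ≤ N) :
    substX f (MvPolynomial.X 0) * homogenizeAt k (shiftedJacobi k b g) ∈
      triangleSpan a b g N := by
  have hbg : -1 < b + g + 2 * (k : ℝ) + 1 := by linarith [(k.cast_nonneg : (0 : ℝ) ≤ k)]
  have hmem := Polynomial.mem_span_image_Iic_of_natDegree_le
    (S := fun i => shiftedJacobi i a (b + g + 2 * (k : ℝ) + 1))
    (fun i => natDegree_shiftedJacobi i ha hbg)
    (fun i h => coeff_shiftedJacobi_self_ne_zero i ha hbg (by simp [h])) (le_refl f.natDegree)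
  let L : Polynomial ℝ →ₗ[ℝ] MvPolynomial (Fin 2) ℝ :=
    (LinearMap.mulRight ℝ (homogenizeAt k (shiftedJacobi k b g))).comp
      (Polynomial.aeval (MvPolynomial.X 0 : MvPolynomial (Fin 2) ℝ)).toLinearMap
  refine (Submodule.span_le (p := (triangleSpan a b g N).comap L)).2 ?_ hmem
  rintro _ ⟨i, hi, rfl⟩
  refine Submodule.subset_span ⟨i + k, k, by omega, ?_, ?_⟩
  · have := Set.mem_Iic.1 hi
    omega
  · rw [trianglePoly, Nat.add_sub_cancel]
    rfl

theorem substX_mul_X_one_pow_mem_triangleSpan {a b g : ℝ} (ha : -1 < a) (hb : -1 < b)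
    (hg : -1 < g) (N : ℕ) (k : ℕ) (f : Polynomial ℝ) (hf : f.natDegree + k ≤ N) :
    substX f (MvPolynomial.X 0) * MvPolynomial.X 1 ^ k ∈ triangleSpan a b g N := by
  induction k using Nat.strong_induction_on generalizing f with
  | _ k ih =>
    have hlead := coeff_shiftedJacobi_self_ne_zero k hb hg
    have hlow : ∑ i ∈ Finset.range k, (shiftedJacobi k b g).coeff i •
        (substX (f * (1 - Polynomial.X) ^ (k - i)) (MvPolynomial.X 0) * MvPolynomial.X 1 ^ i) ∈
          triangleSpan a b g N := by
      refine Submodule.sum_mem _ fun i hi => Submodule.smul_mem _ _ ?_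
      have hik := Finset.mem_range.1 hi
      refine ih i hik _ ?_
      have h1 : ((1 - Polynomial.X : Polynomial ℝ) ^ (k - i)).natDegree ≤ (k - i) * 1 :=
        Polynomial.natDegree_pow_le_of_le _ ((Polynomial.natDegree_sub_le _ _).trans (by simp))
      have h2 := Polynomial.natDegree_mul_le (p := f) (q := (1 - Polynomial.X) ^ (k - i))
      omega
    have hsub := Submodule.sub_mem _
      (substX_mul_homogenizeAt_mem_triangleSpan ha hb hg N hf) hlow
    refine (Submodule.smul_mem_iff _ hlead).1 ?_
    convert hsub using 1
    rw [homogenizeAt, Finset.sum_range_succ, mul_add, Finset.mul_sum, Nat.sub_self, pow_zero,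
      mul_one, add_sub_right_comm, ← Finset.sum_sub_distrib, Finset.sum_eq_zero, zero_add,
      MvPolynomial.smul_eq_C_mul]
    · ring
    · intro i _
      simp only [substX, map_mul, map_pow, map_sub, map_one, Polynomial.aeval_X,
        MvPolynomial.smul_eq_C_mul]
      ring

theorem mem_triangleSpan_of_totalDegree_le {a b g : ℝ} (ha : -1 < a) (hb : -1 < b)
    (hg : -1 < g) (N : ℕ) {u : MvPolynomial (Fin 2) ℝ} (hu : u.totalDegree ≤ N) :
    u ∈ triangleSpan a b g N := by
  rw [u.as_sum]
  refine Submodule.sum_mem _ fun s hs => ?_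
  have hdeg : s 0 + s 1 ≤ N := by
    have := (MvPolynomial.le_totalDegree hs).trans hu
    rwa [Finsupp.sum_fintype _ _ (fun _ => rfl), Fin.sum_univ_two] at this
  have h := substX_mul_X_one_pow_mem_triangleSpan ha hb hg N (s 1)
    (Polynomial.C (u.coeff s) * Polynomial.X ^ s 0)
    ((Nat.add_le_add_right (Polynomial.natDegree_C_mul_X_pow_le _ _) _).trans hdeg)
  convert h using 1
  rw [MvPolynomial.monomial_eq, Finsupp.prod_fintype _ _ (fun _ => pow_zero _), Fin.prod_univ_two]
  simp [substX, mul_assoc, MvPolynomial.algebraMap_eq]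

theorem exists_coef_of_mem_triangleSpan {a b g : ℝ} {N : ℕ} {u : MvPolynomial (Fin 2) ℝ}
    (hu : u ∈ triangleSpan a b g N) :
    ∃ coef : ℕ → ℕ → ℝ, u = ∑ m ∈ Finset.range (N + 1), ∑ j ∈ Finset.range (m + 1),
      coef m j • trianglePoly a b g m j := by
  induction hu using Submodule.span_induction with
  | mem q hq =>
    obtain ⟨m, j, hjm, hmN, rfl⟩ := hq
    refine ⟨fun m' j' => if m' = m then if j' = j then 1 else 0 else 0, ?_⟩
    rw [Finset.sum_eq_single m (fun m' _ h => by simp [h])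
        (fun h => absurd (Finset.mem_range.2 (Nat.lt_succ_of_le hmN)) h),
      Finset.sum_eq_single j (fun j' _ h => by simp [h])
        (fun h => absurd (Finset.mem_range.2 (Nat.lt_succ_of_le hjm)) h)]
    simp
  | zero => exact ⟨0, by simp⟩
  | add p q _ _ hp hq =>
    obtain ⟨c, rfl⟩ := hp
    obtain ⟨d, rfl⟩ := hq
    exact ⟨c + d, by simp [add_smul, Finset.sum_add_distrib]⟩
  | smul r p _ hp =>
    obtain ⟨c, rfl⟩ := hp
    exact ⟨r • c, by simp [Finset.smul_sum, smul_smul]⟩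

/-- Let `α, β, γ > -1`.  There is a family `Q n k` of bivariate
polynomials of total degree `n` (for `k ≤ n`) whose values are
`P_{n,k}^{(α,β,γ)}(x,y) = (1-x)^k P_{n-k}^{(α,β+γ+2k+1)}(1-2x) P_k^{(β,γ)}(1-2y/(1-x))`;
these are pairwise orthogonal in `L²(T₁, x^α y^β (1-x-y)^γ dx dy)`, and for every `N` the
family `{Q m j}_{j ≤ m ≤ N}` spans the bivariate polynomials of total degree at most `N`,
hence is an orthogonal basis of that space. -/
theorem statement10 (a b g : ℝ) (ha : -1 < a) (hb : -1 < b) (hg : -1 < g) :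
    ∃ Q : ℕ → ℕ → MvPolynomial (Fin 2) ℝ,
      (∀ n k : ℕ, k ≤ n → (Q n k).totalDegree = n) ∧
      (∀ n k : ℕ, k ≤ n → ∀ p : ℝ × ℝ, p.1 ≠ 1 →
        evalP (Q n k) p = (1 - p.1) ^ k * jacobiR (n - k) a (b + g + 2 * (k : ℝ) + 1)
          (1 - 2 * p.1) * jacobiR k b g (1 - 2 * p.2 / (1 - p.1))) ∧
      (∀ n k m j : ℕ, k ≤ n → j ≤ m → (n, k) ≠ (m, j) →
        (∫ p in T1, evalP (Q n k) p * evalP (Q m j) p *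
          (p.1 ^ a * p.2 ^ b * (1 - p.1 - p.2) ^ g)) = 0) ∧
      (∀ N : ℕ, ∀ u : MvPolynomial (Fin 2) ℝ, u.totalDegree ≤ N →
        ∃ coef : ℕ → ℕ → ℝ,
          u = ∑ m ∈ Finset.range (N + 1), ∑ j ∈ Finset.range (m + 1),
            coef m j • Q m j) := by
  refine ⟨trianglePoly a b g, fun n k hk => totalDegree_trianglePoly ha hb hg hk, ?_,
    fun n k m j hk hj hne => setIntegral_trianglePoly_mul ha hb hg hk hj hne,
    fun N u hu => exists_coef_of_mem_triangleSpan
      (mem_triangleSpan_of_totalDegree_le ha hb hg N hu)⟩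
  intro n k _ p hp
  rw [evalP_trianglePoly _ _ _ _ _ hp, eval_shiftedJacobi, eval_shiftedJacobi, mul_div_assoc]
  ring
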